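/- There exists a reduced basis of M_K with respect to v: that is, there is a K-basis (f_1, …, f_n) of M_K such that for all a_1, …, a_n ∈ K one has v(Σ_j a_j f_j) = min_j v(a_j f_j). -/

import Mathlib

namespace ReducedBases

variable {K : Type*} [Field K]

/-- A normalized discrete valuation `v : K → ℤ ∪ {∞}` with `v(K^×) = ℤ`. -/
structure ZVal (K : Type*) [Field K] where
  v : K → WithTop ℤ
  map_mul' : ∀ a b : K, v (a * b) = v a + v b
  map_one' : v 1 = 0
  min_le_add' : ∀ a b : K, min (v a) (v b) ≤ v (a + b)
  eq_top_iff' : ∀ a : K, v a = ⊤ ↔ a = 0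
  surj' : ∀ n : ℤ, ∃ a : K, v a = (n : WithTop ℤ)

/-- `K` is complete with respect to `v_K`: every Cauchy sequence converges. -/
def ZVal.IsComplete (vK : ZVal K) : Prop :=
  ∀ a : ℕ → K,
    (∀ M : ℤ, ∃ N : ℕ, ∀ m, N ≤ m → ∀ n, N ≤ n → (M : WithTop ℤ) ≤ vK.v (a m - a n)) →
    ∃ b : K, ∀ M : ℤ, ∃ N : ℕ, ∀ n, N ≤ n → (M : WithTop ℤ) ≤ vK.v (a n - b)


namespace ZVal

theorem v_zero (v : ZVal K) : v.v 0 = ⊤ := (v.eq_top_iff' 0).2 rfl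

theorem v_neg (v : ZVal K) (a : K) : v.v (-a) = v.v a := by
  have h : v.v (-1) = 0 := by
    have h2 : v.v (-1) + v.v (-1) = 0 := by
      rw [← v.map_mul', neg_mul_neg, one_mul, v.map_one']
    generalize v.v (-1) = x at h2
    induction x with
    | top => simp at h2
    | coe x =>
      norm_cast at h2 ⊢
      omega
  rw [← neg_one_mul, v.map_mul', h, zero_add]

theorem le_v_add (v : ZVal K) {a b : K} {M : WithTop ℤ} (ha : M ≤ v.v a) (hb : M ≤ v.v b) :
    M ≤ v.v (a + b) :=
  (le_min ha hb).trans (v.min_le_add' a b)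

theorem le_v_sub (v : ZVal K) {a b : K} {M : WithTop ℤ} (ha : M ≤ v.v a) (hb : M ≤ v.v b) :
    M ≤ v.v (a - b) := by
  rw [sub_eq_add_neg]
  exact v.le_v_add ha ((v.v_neg b).symm ▸ hb)

theorem le_v_sum (v : ZVal K) {ι : Type*} (s : Finset ι) (f : ι → K) {M : WithTop ℤ}
    (h : ∀ i ∈ s, M ≤ v.v (f i)) : M ≤ v.v (∑ i ∈ s, f i) :=
  Finset.sum_induction f (fun x => M ≤ v.v x) (fun _ _ => v.le_v_add)
    (by rw [v.v_zero]; exact le_top) h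

theorem exists_v_eq_coe (v : ZVal K) {a : K} (ha : a ≠ 0) : ∃ c : ℤ, v.v a = c := by
  obtain ⟨c, hc⟩ := WithTop.ne_top_iff_exists.1 (mt (v.eq_top_iff' a).1 ha)
  exact ⟨c, hc.symm⟩

/-- An element whose valuation is maximal in its coset modulo an additive subgroup is
orthogonal to that subgroup. -/
theorem v_add_eq_min (v : ZVal K) {x u : K} (h : v.v (x + u) ≤ v.v x) :
    v.v (x + u) = min (v.v x) (v.v u) := by
  refine le_antisymm (le_min h ?_) (v.min_le_add' x u)
  simpa using v.le_v_sub le_rfl h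

end ZVal

section Reduced

variable {F : Type*} [Field F] [Algebra K F] {vK : ZVal K} {v : ZVal F} {e : ℕ}

/-- A finite system is reduced if the valuation of every linear combination is the minimum of
the valuations of its terms. -/
def IsReduced (K : Type*) [Field K] {F : Type*} [Field F] [Algebra K F] (v : ZVal F) {n : ℕ}
    (f : Fin n → F) : Prop :=
  ∀ a : Fin n → K, v.v (∑ j, a j • f j) = Finset.univ.inf fun j => v.v (a j • f j)

theorem v_smul (hres : ∀ a : K, v.v (algebraMap K F a) = e • vK.v a) (a : K) (x : F) :
    v.v (a • x) = e • vK.v a + v.v x := by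
  rw [Algebra.smul_def, v.map_mul', hres]

theorem le_of_le_nsmul_add (he : 0 < e) {x : WithTop ℤ} {c M : ℤ}
    (h : ((e * M + c : ℤ) : WithTop ℤ) ≤ e • x + c) : (M : WithTop ℤ) ≤ x := by
  induction x with
  | top => exact le_top
  | coe x =>
    rw [← WithTop.coe_nsmul] at h
    norm_cast at h ⊢
    rw [nsmul_eq_mul] at h
    have : (0 : ℤ) < e := by exact_mod_cast he
    nlinarith

theorem le_nsmul_add (he : 0 < e) {x : WithTop ℤ} {c M : ℤ}
    (h : ((max (M - c) 0 : ℤ) : WithTop ℤ) ≤ x) : (M : WithTop ℤ) ≤ e • x + c := by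
  induction x with
  | top =>
    obtain ⟨k, rfl⟩ := Nat.exists_eq_succ_of_ne_zero he.ne'
    simp [succ_nsmul]
  | coe x =>
    rw [← WithTop.coe_nsmul]
    norm_cast at h ⊢
    rw [nsmul_eq_mul]
    have : (1 : ℤ) ≤ e := by exact_mod_cast he
    have h1 := (le_max_left _ _).trans h
    have h2 := (le_max_right _ _).trans h
    nlinarith

theorem IsReduced.linearIndependent {n : ℕ} {f : Fin n → F} (hf : IsReduced K v f)
    (h0 : ∀ j, f j ≠ 0) : LinearIndependent K f := by
  rw [Fintype.linearIndependent_iff]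
  intro a ha j
  have h := hf a
  rw [ha, v.v_zero] at h
  have hj : v.v (a j • f j) = ⊤ :=
    top_le_iff.1 (h.trans_le (Finset.inf_le (Finset.mem_univ j)))
  exact (smul_eq_zero.1 ((v.eq_top_iff' _).1 hj)).resolve_right (h0 j)

/-- The span of a reduced system over a complete field is closed. -/
theorem IsReduced.mem_span_of_approx (hK : vK.IsComplete) (he : 0 < e)
    (hres : ∀ a : K, v.v (algebraMap K F a) = e • vK.v a) {n : ℕ} {f : Fin n → F}
    (hf : IsReduced K v f) (h0 : ∀ j, f j ≠ 0) {g : F}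
    (hg : ∀ M : ℤ, ∃ w ∈ Submodule.span K (Set.range f), (M : WithTop ℤ) ≤ v.v (g - w)) :
    g ∈ Submodule.span K (Set.range f) := by
  choose c hc using fun j => v.exists_v_eq_coe (h0 j)
  have hg' : ∀ k : ℕ, ∃ a : Fin n → K, ((k : ℤ) : WithTop ℤ) ≤ v.v (g - ∑ j, a j • f j) := by
    intro k
    obtain ⟨w, hw, hk⟩ := hg k
    obtain ⟨a, rfl⟩ := (Submodule.mem_span_range_iff_exists_fun K).1 hw
    exact ⟨a, hk⟩
  choose a ha using hg'
  have ha' : ∀ (M : ℤ) (k : ℕ), M.toNat ≤ k →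
      (M : WithTop ℤ) ≤ v.v (g - ∑ j, a k j • f j) := fun M k hk =>
    le_trans (by norm_cast; omega) (ha k)
  have hcauchy : ∀ j, ∃ b : K, ∀ M : ℤ, ∃ N : ℕ, ∀ k, N ≤ k →
      (M : WithTop ℤ) ≤ vK.v (a k j - b) := by
    intro j
    refine hK (fun k => a k j) fun M => ⟨(e * M + c j).toNat, fun k hk l hl => ?_⟩
    have h := v.le_v_sub (ha' _ l hl) (ha' _ k hk)
    have hsum : (g - ∑ j, a l j • f j) - (g - ∑ j, a k j • f j)
        = ∑ j, (a k j - a l j) • f j := by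
      simp only [sub_smul, Finset.sum_sub_distrib]
      ring
    rw [hsum, hf fun j => a k j - a l j] at h
    have hj := h.trans (Finset.inf_le (Finset.mem_univ j))
    rw [v_smul hres, hc] at hj
    exact le_of_le_nsmul_add he hj
  choose b hb using hcauchy
  rw [Submodule.mem_span_range_iff_exists_fun]
  refine ⟨b, ?_⟩
  by_contra hne
  obtain ⟨d, hd⟩ := v.exists_v_eq_coe (sub_ne_zero.2 (Ne.symm hne))
  choose N hN using fun j => hb j (max (d + 1 - c j) 0)
  let k := max (d + 1).toNat (Finset.univ.sup N)
  have h1 := ha' (d + 1) k (le_max_left _ _)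
  have h2 : ((d + 1 : ℤ) : WithTop ℤ) ≤ v.v (∑ j, (a k j - b j) • f j) := by
    refine v.le_v_sum _ _ fun j _ => ?_
    rw [v_smul hres, hc]
    exact le_nsmul_add he
      (hN j k ((Finset.le_sup (Finset.mem_univ j)).trans (le_max_right _ _)))
  have h3 := v.le_v_add h1 h2
  have hsum : (g - ∑ j, a k j • f j) + ∑ j, (a k j - b j) • f j = g - ∑ j, b j • f j := by
    simp only [sub_smul, Finset.sum_sub_distrib]
    ring
  rw [hsum, hd] at h3
  norm_cast at h3
  omega

/-- A vector outside the span of a reduced system over a complete field has a best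
approximation in that span. -/
theorem IsReduced.exists_best_approx (hK : vK.IsComplete) (he : 0 < e)
    (hres : ∀ a : K, v.v (algebraMap K F a) = e • vK.v a) {n : ℕ} {f : Fin n → F}
    (hf : IsReduced K v f) (h0 : ∀ j, f j ≠ 0) {g : F}
    (hg : g ∉ Submodule.span K (Set.range f)) :
    ∃ w ∈ Submodule.span K (Set.range f), ∀ u ∈ Submodule.span K (Set.range f),
      v.v (g - u) ≤ v.v (g - w) := by
  have hbdd : ∃ B : ℤ, ∀ w ∈ Submodule.span K (Set.range f), v.v (g - w) < B := by
    by_contra! h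
    exact hg (hf.mem_span_of_approx hK he hres h0 h)
  obtain ⟨B, hB⟩ := hbdd
  obtain ⟨d, hd⟩ := v.exists_v_eq_coe (a := g - 0) (by
    rw [sub_zero]
    rintro rfl
    exact hg (Submodule.zero_mem _))
  obtain ⟨m, ⟨w, hw, hm⟩, hmax⟩ := Int.exists_greatest_of_bdd
    (P := fun m : ℤ => ∃ w ∈ Submodule.span K (Set.range f), v.v (g - w) = m)
    ⟨B, fun m ⟨w, hw, hm⟩ => by
      have := hB w hw
      rw [hm] at this
      exact_mod_cast this.le⟩
    ⟨d, 0, Submodule.zero_mem _, hd⟩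
  refine ⟨w, hw, fun u hu => ?_⟩
  obtain ⟨l, hl⟩ := v.exists_v_eq_coe (a := g - u)
    (sub_ne_zero.2 fun h => hg (h ▸ hu))
  rw [hl, hm]
  exact_mod_cast hmax l ⟨u, hu, hl⟩

theorem IsReduced.cons (hres : ∀ a : K, v.v (algebraMap K F a) = e • vK.v a) {n : ℕ}
    {f : Fin n → F} (hf : IsReduced K v f) {x : F}
    (hx : ∀ u ∈ Submodule.span K (Set.range f), v.v (x + u) ≤ v.v x) :
    IsReduced K v (Fin.cons x f : Fin (n + 1) → F) := by
  intro a
  rw [Fin.sum_univ_succ, Fin.univ_succ, Finset.inf_cons, Finset.inf_map]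
  simp only [Fin.cons_zero, Fin.cons_succ, Function.comp_def, Function.Embedding.coeFn_mk]
  rw [← hf fun j => a j.succ]
  have hu : ∑ j, a (Fin.succ j) • f j ∈ Submodule.span K (Set.range f) :=
    (Submodule.mem_span_range_iff_exists_fun K).2 ⟨_, rfl⟩
  refine v.v_add_eq_min ?_
  generalize ∑ j, a (Fin.succ j) • f j = u at hu
  rcases eq_or_ne (a 0) 0 with h | h
  · rw [h, zero_smul, v.v_zero]
    exact le_top
  · have h1 : a 0 • x + u = a 0 • (x + (a 0)⁻¹ • u) := by
      rw [smul_add, smul_inv_smul₀ h]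
    rw [h1, v_smul hres, v_smul hres]
    gcongr
    exact hx _ (Submodule.smul_mem _ _ hu)

theorem exists_isReduced_span_eq (hK : vK.IsComplete) (he : 0 < e)
    (hres : ∀ a : K, v.v (algebraMap K F a) = e • vK.v a) {n : ℕ} (g : Fin n → F)
    (hg : LinearIndependent K g) :
    ∃ f : Fin n → F, (∀ j, f j ≠ 0) ∧
      Submodule.span K (Set.range f) = Submodule.span K (Set.range g) ∧ IsReduced K v f := by
  induction n with
  | zero =>
    exact ⟨g, fun j => j.elim0, rfl, fun a => by simp [v.v_zero]⟩
  | succ n ih =>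
    rw [linearIndependent_finSucc] at hg
    obtain ⟨f, h0, hspan, hf⟩ := ih (Fin.tail g) hg.1
    have hg0 : g 0 ∉ Submodule.span K (Set.range f) := hspan ▸ hg.2
    obtain ⟨w, hw, hmax⟩ := hf.exists_best_approx hK he hres h0 hg0
    refine ⟨Fin.cons (g 0 - w) f, ?_, ?_, hf.cons hres fun u hu => ?_⟩
    · refine Fin.cases ?_ h0
      rw [Fin.cons_zero, sub_ne_zero]
      intro h
      exact hg0 (h ▸ hw)
    · rw [← Fin.cons_self_tail g, Fin.range_cons, Fin.range_cons, Submodule.span_insert,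
        Submodule.span_insert, ← hspan, Fin.cons_zero]
      apply le_antisymm
      · refine sup_le ?_ le_sup_right
        rw [Submodule.span_singleton_le_iff_mem]
        exact Submodule.sub_mem _
          (Submodule.mem_sup_left (Submodule.mem_span_singleton_self _))
          (Submodule.mem_sup_right hw)
      · refine sup_le ?_ le_sup_right
        rw [Submodule.span_singleton_le_iff_mem, ← sub_add_cancel (g 0) w]
        exact Submodule.add_mem _
          (Submodule.mem_sup_left
            (by rw [sub_add_cancel]; exact Submodule.mem_span_singleton_self _))
          (Submodule.mem_sup_right hw)
    · rw [sub_add]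
      exact hmax _ (Submodule.sub_mem _ hw hu)

end Reduced

/-- there exists a reduced `K`-basis `(f_1, …, f_n)` of `M_K` with respect
to `v`: a basis such that `v (∑ a_j f_j) = min_j v (a_j f_j)` for all `a_j ∈ K`. -/
theorem exists_reduced_basis {F : Type*} [Field F] [Algebra K F]
    (vK : ZVal K) (hK : vK.IsComplete)
    (v : ZVal F) (e : ℕ) (he : 0 < e)
    (hres : ∀ a : K, v.v (algebraMap K F a) = e • vK.v a)
    (M : Subspace K F) [FiniteDimensional K ↥M] (n : ℕ)
    (hn : Module.finrank K ↥M = n) :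
    ∃ f : Fin n → F, (∀ j, f j ∈ M) ∧ LinearIndependent K f ∧
      Submodule.span K (Set.range f) = M ∧
      ∀ a : Fin n → K,
        v.v (∑ j, a j • f j) = Finset.univ.inf fun j => v.v (a j • f j) := by
  let b := Module.finBasisOfFinrankEq K M hn
  have hb : LinearIndependent K fun j => (b j : F) :=
    b.linearIndependent.map' M.subtype M.ker_subtype
  have hbM : Submodule.span K (Set.range fun j => (b j : F)) = M := by
    have h := congrArg (Submodule.map M.subtype) b.span_eq
    rw [Submodule.map_span, ← Set.range_comp, Submodule.map_top, Submodule.range_subtype] at h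
    exact h
  obtain ⟨f, h0, hspan, hf⟩ := exists_isReduced_span_eq hK he hres _ hb
  rw [hbM] at hspan
  exact ⟨f, fun j => hspan ▸ Submodule.subset_span ⟨j, rfl⟩, hf.linearIndependent h0, hspan, hf⟩

end ReducedBases
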